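/- arXiv:2409.17658 — 2 statements merged into one kernel-verified Lean document; each statement's English description precedes it below -/
import Mathlib

section
/- For all integers m, n ≥ 10, the Roman domination number of the cylinder P_m □ C_n satisfies ⌈2(m+1)n/5⌉ ≤ γ_R(P_m □ C_n). -/
open SimpleGraph

/-- A Roman dominating function on `G`: every vertex with value `0` has a neighbor
with value `2`. -/
def IsRomanDominating {V : Type*} (G : SimpleGraph V) (f : V → Fin 3) : Prop :=
  ∀ v, f v = 0 → ∃ w, G.Adj v w ∧ f w = 2

/-- The Roman domination number of a finite graph: the minimum weight
`∑ v, f v` of a Roman dominating function on `G`. -/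
noncomputable def romanDominationNumber {V : Type*} [Fintype V] (G : SimpleGraph V) : ℕ :=
  sInf {k | ∃ f : V → Fin 3, IsRomanDominating G f ∧ ∑ v, (f v : ℕ) = k}

/-- Packed potential table (one hexadecimal digit for each pair of consecutive
columns of height four). -/
def potTable : ℕ :=
  59923104495410530228407564325434160545149163072179990332362111294285602962950727778925610430988333113678775279612998552242765837061203809702258448422724383542776941745556971852372472999997261816893782393071696718032975353714920942338006737186400897904297408182011848124045884617796012365926620536725733200452

/-- Potential of a pair of consecutive columns, given by their binary codes. -/
def pot (a b : ℕ) : ℕ := potTable / 16 ^ (a + 16 * b) % 16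

/-- Loss of a cell with `t` dominators (twice the usual loss). -/
def cellLoss (t : ℕ) : ℕ := if t = 0 then 3 else 2 * (t - 1)

/-- Loss of the middle column `b` of three columns `a`, `b`, `c` of height four. -/
def colLoss (a1 a2 a3 a4 b1 b2 b3 b4 c1 c2 c3 c4 : ℕ) : ℕ :=
  2 * b1 + cellLoss (a1 + b1 + c1 + b2) + cellLoss (a2 + b2 + c2 + b1 + b3)
    + cellLoss (a3 + b3 + c3 + b2 + b4) + 2 * (a4 + b4 + c4 + b3 - 1)

def code (a1 a2 a3 a4 : ℕ) : ℕ := a1 + 2 * a2 + 4 * a3 + 8 * a4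

def bits (s i : ℕ) : ℕ := s / 2 ^ i % 2

def chk (s : ℕ) : Bool :=
  Nat.ble (1 + pot (s / 16 % 16) (s / 256))
    (colLoss (bits s 0) (bits s 1) (bits s 2) (bits s 3) (bits s 4) (bits s 5) (bits s 6)
      (bits s 7) (bits s 8) (bits s 9) (bits s 10) (bits s 11) + pot (s % 16) (s / 16 % 16))

theorem chk_all : (List.range 64).all (fun a =>
    (List.range 64).all (fun b => chk (64 * a + b))) = true := by decide +kernel

theorem pot_step (a1 a2 a3 a4 b1 b2 b3 b4 c1 c2 c3 c4 : ℕ)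
    (ha1 : a1 ≤ 1) (ha2 : a2 ≤ 1) (ha3 : a3 ≤ 1) (ha4 : a4 ≤ 1)
    (hb1 : b1 ≤ 1) (hb2 : b2 ≤ 1) (hb3 : b3 ≤ 1) (hb4 : b4 ≤ 1)
    (hc1 : c1 ≤ 1) (hc2 : c2 ≤ 1) (hc3 : c3 ≤ 1) (hc4 : c4 ≤ 1) :
    1 + pot (code b1 b2 b3 b4) (code c1 c2 c3 c4) ≤
      colLoss a1 a2 a3 a4 b1 b2 b3 b4 c1 c2 c3 c4
        + pot (code a1 a2 a3 a4) (code b1 b2 b3 b4) := by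
  obtain ⟨s, hs⟩ : ∃ s, s = code a1 a2 a3 a4 + 16 * code b1 b2 b3 b4
      + 256 * code c1 c2 c3 c4 := ⟨_, rfl⟩
  have h := List.all_eq_true.1 (List.all_eq_true.1 chk_all (s / 64) (by
    rw [List.mem_range]; unfold code at hs; omega)) (s % 64) (by
    rw [List.mem_range]; omega)
  rw [Nat.div_add_mod] at h
  unfold code at hs
  unfold chk at h
  have e0 : s % 16 = code a1 a2 a3 a4 := by unfold code; omega
  have e1 : s / 16 % 16 = code b1 b2 b3 b4 := by unfold code; omega
  have e2 : s / 256 = code c1 c2 c3 c4 := by unfold code; omega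
  have f0 : bits s 0 = a1 := by unfold bits; omega
  have f1 : bits s 1 = a2 := by unfold bits; omega
  have f2 : bits s 2 = a3 := by unfold bits; omega
  have f3 : bits s 3 = a4 := by unfold bits; omega
  have f4 : bits s 4 = b1 := by unfold bits; omega
  have f5 : bits s 5 = b2 := by unfold bits; omega
  have f6 : bits s 6 = b3 := by unfold bits; omega
  have f7 : bits s 7 = b4 := by unfold bits; omega
  have f8 : bits s 8 = c1 := by unfold bits; omega
  have f9 : bits s 9 = c2 := by unfold bits; omega
  have f10 : bits s 10 = c3 := by unfold bits; omega
  have f11 : bits s 11 = c4 := by unfold bits; omega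
  rw [e0, e1, e2, f0, f1, f2, f3, f4, f5, f6, f7, f8, f9, f10, f11] at h
  exact Nat.le_of_ble_eq_true h

theorem cellLoss_le (t o : ℕ) (h : 1 ≤ t + o) : cellLoss t + 2 ≤ 2 * t + 5 * o := by
  unfold cellLoss; split_ifs <;> omega

/-- number of dominators of the cell in row `i + 1` and column `j` -/
def dom {n : ℕ} [NeZero n] (x : ℕ → Fin n → ℕ) (i : ℕ) (j : Fin n) : ℕ :=
  x (i + 1) (j - 1) + x (i + 1) j + x (i + 1) (j + 1) + x i j + x (i + 2) j

theorem sum_shift {n : ℕ} [NeZero n] (g : Fin n → ℕ) : ∑ j, g (j + 1) = ∑ j, g j :=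
  Equiv.sum_comp (Equiv.addRight (1 : Fin n)) g

theorem sum_shift' {n : ℕ} [NeZero n] (g : Fin n → ℕ) : ∑ j, g (j - 1) = ∑ j, g j :=
  Equiv.sum_comp (Equiv.subRight (1 : Fin n)) g

/-- The loss along one border of the cylinder. -/
theorem border {n : ℕ} [NeZero n] (x o : ℕ → Fin n → ℕ) (hx : ∀ i j, x i j ≤ 1)
    (h0 : ∀ j, x 0 j = 0) (hd : ∀ i j, i < 4 → 1 ≤ dom x i j + o i j) :
    9 * n ≤ 2 * ∑ j, x 1 j + ∑ j, (2 * dom x 0 j + 5 * o 0 j)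
      + ∑ j, (2 * dom x 1 j + 5 * o 1 j) + ∑ j, (2 * dom x 2 j + 5 * o 2 j)
      + ∑ j, (2 * dom x 3 j + 5 * o 3 j) := by
  let cd : Fin n → ℕ := fun j => code (x 1 j) (x 2 j) (x 3 j) (x 4 j)
  let P : Fin n → ℕ := fun j => pot (cd (j - 1)) (cd j)
  have key : ∀ j, 9 + P (j + 1) ≤ 2 * x 1 j + (2 * dom x 0 j + 5 * o 0 j)
      + (2 * dom x 1 j + 5 * o 1 j) + (2 * dom x 2 j + 5 * o 2 j)
      + (2 * dom x 3 j + 5 * o 3 j) + P j := by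
    intro j
    have hs := pot_step (x 1 (j - 1)) (x 2 (j - 1)) (x 3 (j - 1)) (x 4 (j - 1))
      (x 1 j) (x 2 j) (x 3 j) (x 4 j) (x 1 (j + 1)) (x 2 (j + 1)) (x 3 (j + 1)) (x 4 (j + 1))
      (hx _ _) (hx _ _) (hx _ _) (hx _ _) (hx _ _) (hx _ _) (hx _ _) (hx _ _)
      (hx _ _) (hx _ _) (hx _ _) (hx _ _)
    have hP : P (j + 1) = pot (cd j) (cd (j + 1)) := by simp only [P, add_sub_cancel_right]
    rw [hP]
    simp only [P, cd]
    unfold colLoss at hs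
    have d0 := cellLoss_le _ _ (hd 0 j (by omega))
    have d1 := cellLoss_le _ _ (hd 1 j (by omega))
    have d2 := cellLoss_le _ _ (hd 2 j (by omega))
    have d3 := hd 3 j (by omega)
    have e0 : x 1 (j - 1) + x 1 j + x 1 (j + 1) + x 2 j = dom x 0 j := by
      simp [dom, h0]
    have e1 : x 2 (j - 1) + x 2 j + x 2 (j + 1) + x 1 j + x 3 j = dom x 1 j := rfl
    have e2 : x 3 (j - 1) + x 3 j + x 3 (j + 1) + x 2 j + x 4 j = dom x 2 j := rfl
    have e3 : x 4 (j - 1) + x 4 j + x 4 (j + 1) + x 3 j + x 5 j = dom x 3 j := rfl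
    rw [e0, e1, e2] at hs
    omega
  have := Finset.sum_le_sum (fun j (_ : j ∈ Finset.univ) => key j)
  simp only [Finset.sum_add_distrib, ← Finset.mul_sum, sum_shift P] at this
  simp only [Finset.sum_add_distrib, ← Finset.mul_sum]
  simp only [Finset.sum_const, Finset.card_univ, Fintype.card_fin, smul_eq_mul] at this
  omega

/-- The main inequality for zero-one arrays. -/
theorem main_ineq {n : ℕ} [NeZero n] (m : ℕ) (hm : 8 ≤ m) (x o : ℕ → Fin n → ℕ)
    (hx : ∀ i j, x i j ≤ 1) (h0 : ∀ j, x 0 j = 0) (h1 : ∀ j, x (m + 1) j = 0)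
    (hd : ∀ i j, i < m → 1 ≤ dom x i j + o i j) :
    2 * (m + 1) * n ≤ 5 * ∑ i ∈ Finset.range m, ∑ j, (2 * x (i + 1) j + o i j) := by
  obtain ⟨M, rfl⟩ : ∃ M, m = M + 8 := ⟨m - 8, by omega⟩
  have top := border x o hx h0 (fun i j h => hd i j (by omega))
  have bot := border (fun i j => x (M + 9 - i) j) (fun i j => o (M + 7 - i) j)
    (fun i j => hx _ _) (fun j => h1 j) (by
      intro i j h
      have := hd (M + 7 - i) j (by omega)
      have e1 : M + 9 - (i + 1) = M + 7 - i + 1 := by omega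
      have e2 : M + 9 - (i + 2) = M + 7 - i := by omega
      have e3 : M + 9 - i = M + 7 - i + 2 := by omega
      simp only [dom, e1, e2, e3] at this ⊢
      omega)
  let C : ℕ → ℕ := fun i => ∑ j, (2 * dom x i j + 5 * o i j)
  have mid : ∀ i < M, 2 * n ≤ C (i + 4) := by
    intro i hi
    have : ∑ j : Fin n, 2 ≤ C (i + 4) := Finset.sum_le_sum (fun j _ => by
      have := hd (i + 4) j (by omega)
      omega)
    simpa [mul_comm] using this
  have midsum : M * (2 * n) ≤ ∑ i ∈ Finset.range M, C (i + 4) := by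
    have := Finset.sum_le_sum (fun i (hi : i ∈ Finset.range M) => mid i (Finset.mem_range.1 hi))
    simpa using this
  have dec : ∑ i ∈ Finset.range (M + 8), C i = C 0 + C 1 + C 2 + C 3
      + ∑ i ∈ Finset.range M, C (i + 4) + C (M + 4) + C (M + 5) + C (M + 6) + C (M + 7) := by
    rw [Finset.sum_range_succ, Finset.sum_range_succ, Finset.sum_range_succ,
      Finset.sum_range_succ, Finset.sum_range_succ', Finset.sum_range_succ',
      Finset.sum_range_succ', Finset.sum_range_succ']
    ring
  let R : ℕ → ℕ := fun i => ∑ j, x i j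
  have hC : ∀ i, C i = 6 * R (i + 1) + 2 * R i + 2 * R (i + 2) + 5 * ∑ j, o i j := by
    intro i
    simp only [C, R, dom, Finset.sum_add_distrib, ← Finset.mul_sum, sum_shift (x (i + 1)),
      sum_shift' (x (i + 1))]
    ring
  have hR0 : R 0 = 0 := by simp [R, h0]
  have hR1 : R (M + 9) = 0 := by simp only [R]; exact Finset.sum_eq_zero (fun j _ => h1 j)
  have s1 : ∑ i ∈ Finset.range (M + 8), R i + R (M + 8)
      = ∑ i ∈ Finset.range (M + 8), R (i + 1) := by
    rw [← Finset.sum_range_succ, Finset.sum_range_succ', hR0, add_zero]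
  have s2 : ∑ i ∈ Finset.range (M + 8), R (i + 2) + R 1
      = ∑ i ∈ Finset.range (M + 8), R (i + 1) := by
    have := Finset.sum_range_succ' (fun i => R (i + 1)) (M + 8)
    rw [Finset.sum_range_succ] at this
    have h9 : R (M + 8 + 1) = 0 := hR1
    simp only [h9, add_zero, zero_add] at this
    exact this.symm
  have tot : ∑ i ∈ Finset.range (M + 8), C i + 2 * R 1 + 2 * R (M + 8)
      = 5 * ∑ i ∈ Finset.range (M + 8), ∑ j, (2 * x (i + 1) j + o i j) := by
    have e : ∀ i, ∑ j, (2 * x (i + 1) j + o i j) = 2 * R (i + 1) + ∑ j, o i j := by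
      intro i; simp only [R, Finset.sum_add_distrib, ← Finset.mul_sum]
    simp only [hC, e, Finset.sum_add_distrib, ← Finset.mul_sum]
    omega
  have top' : 9 * n ≤ 2 * R 1 + C 0 + C 1 + C 2 + C 3 := top
  have rev : ∀ i j, i ≤ 3 → dom (fun i j => x (M + 9 - i) j) i j = dom x (M + 7 - i) j := by
    intro i j h
    have e1 : M + 9 - (i + 1) = M + 7 - i + 1 := by omega
    have e2 : M + 9 - (i + 2) = M + 7 - i := by omega
    have e3 : M + 9 - i = M + 7 - i + 2 := by omega
    simp only [dom, e1, e2, e3]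
    omega
  have bot' : 9 * n ≤ 2 * R (M + 8) + C (M + 7) + C (M + 6) + C (M + 5) + C (M + 4) := by
    simp only [rev 0 _ (by omega), rev 1 _ (by omega), rev 2 _ (by omega),
      rev 3 _ (by omega)] at bot
    exact bot
  rw [← tot, dec]
  nlinarith

theorem roman_weight (m n : ℕ) (hm : 10 ≤ m) (hn : 10 ≤ n) (f : Fin m × Fin n → Fin 3)
    (hf : IsRomanDominating ((pathGraph m).boxProd (cycleGraph n)) f) :
    2 * (m + 1) * n ≤ 5 * ∑ v, (f v : ℕ) := by
  obtain ⟨k, rfl⟩ : ∃ k, n = k + 2 := ⟨n - 2, by omega⟩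
  let x : ℕ → Fin (k + 2) → ℕ := fun i j =>
    if h : 1 ≤ i ∧ i ≤ m then (if f (⟨i - 1, by omega⟩, j) = 2 then 1 else 0) else 0
  let o : ℕ → Fin (k + 2) → ℕ := fun i j =>
    if h : i < m then (if f (⟨i, h⟩, j) = 1 then 1 else 0) else 0
  have hxv : ∀ (i : Fin m) j, f (i, j) = 2 → x (i.1 + 1) j = 1 := by
    intro i j h
    have : i.1 + 1 ≤ m := i.2
    simp [x, h, this]
  have := main_ineq m (by omega) x o
    (by intro i j; simp only [x]; split_ifs <;> omega)
    (by intro j; simp [x]) (by intro j; simp [x]) (by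
      intro i j hi
      by_cases ho : f (⟨i, hi⟩, j) = 1
      · have : o i j = 1 := by simp [o, hi, ho]
        omega
      by_cases h2 : f (⟨i, hi⟩, j) = 2
      · have := hxv _ _ h2
        simp only [dom] at this ⊢
        omega
      have h0 : f (⟨i, hi⟩, j) = 0 := by
        generalize f (⟨i, hi⟩, j) = y at *
        fin_cases y <;> simp_all
      obtain ⟨⟨i', j'⟩, hadj, hw⟩ := hf _ h0
      have hw' := hxv _ _ hw
      rw [boxProd_adj] at hadj
      simp only [dom]
      rcases hadj with ⟨ha, rfl⟩ | ⟨ha, hb⟩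
      · rw [pathGraph_adj] at ha
        simp only at ha hw'
        rcases ha with ha | ha
        · rw [← ha] at hw'
          have hw2 : x (i + 2) j = 1 := hw'
          omega
        · rw [ha] at hw'
          omega
      · simp only at ha hb
        subst hb
        rw [cycleGraph_adj] at ha
        simp only at hw'
        rcases ha with ha | ha
        · have : j' = j - 1 := by rw [← ha]; abel
          rw [this] at hw'
          omega
        · have : j' = j + 1 := by rw [← ha]; abel
          rw [this] at hw'
          omega)
  have e : ∑ v, (f v : ℕ)
      = ∑ i ∈ Finset.range m, ∑ j, (2 * x (i + 1) j + o i j) := by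
    rw [Fintype.sum_prod_type, ← Fin.sum_univ_eq_sum_range
      (fun i => ∑ j, (2 * x (i + 1) j + o i j))]
    refine Finset.sum_congr rfl (fun i _ => Finset.sum_congr rfl (fun j _ => ?_))
    have hi : i.1 + 1 ≤ m := i.2
    simp only [x, o, i.2, dif_pos, Nat.add_sub_cancel, hi, Nat.le_add_left, and_self, Fin.eta]
    generalize f (i, j) = y
    fin_cases y <;> simp
  rw [e]
  exact this

/-- for `m, n ≥ 10`, `⌈2(m+1)n/5⌉ ≤ γ_R(P_m □ C_n)`. -/
theorem ceil_le_romanDominationNumber_cylinder (m n : ℕ) (hm : 10 ≤ m) (hn : 10 ≤ n) :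
    ⌈(2 * ((m : ℚ) + 1) * n) / 5⌉₊ ≤
      romanDominationNumber ((pathGraph m).boxProd (cycleGraph n)) := by
  unfold romanDominationNumber
  refine le_csInf ⟨_, fun _ => 1, fun v h => absurd h one_ne_zero, rfl⟩ ?_
  rintro w ⟨f, hf, rfl⟩
  have h := roman_weight m n hm hn f hf
  rw [Nat.ceil_le, div_le_iff₀ (by norm_num)]
  have h' : ((2 * (m + 1) * n : ℕ) : ℚ) ≤ ((5 * ∑ v, (f v : ℕ) : ℕ) : ℚ) := by exact_mod_cast h
  push_cast at h' ⊢
  linarith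
end

section
/- For all integers m, n ≥ 10 with n ≡ 0 (mod 5), the Roman domination number of the cylinder P_m □ C_n equals 2(m+1)n/5. -/
open SimpleGraph

namespace RomanCyl

/-- indicator of the value two -/
def tw (x : ℕ) : ℕ := if x = 2 then 1 else 0

/-- indicator of the value one -/
def on (x : ℕ) : ℕ := if x = 1 then 1 else 0

/-- excess of a cell of value `c` already hit by `k` twos (doubled) -/
def exA (k c : ℕ) : ℕ := if c = 1 then 2 * k + 3 else 2 * (k - 1)

/-- status of a cell: `0` undominated, `1` dominated, `2` value one, `3` value two -/
def nx (k c : ℕ) : ℕ := if c = 2 then 3 else if c = 1 then 2 else if k = 0 then 0 else 1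

/-- additional excess caused in a cell of status `s` by its right neighbour `c` -/
def exB (s c : ℕ) : ℕ := if c = 2 then (if s = 0 then 0 else 2) else 0

/-- indicator of status three -/
def th (s : ℕ) : ℕ := if s = 3 then 1 else 0

/-- potential of a column state (octal digits of a number) -/
def pot (a b c d : ℕ) : ℕ :=
  (38272693535456297146229993672876769593402538650465168930994423282791813599047656157831509609559065870744825868113600501367105617232040986203719391146692592085034216714681170382994772866705847136600082
    >>> (3 * (a + 4 * b + 16 * c + 64 * d))) % 8

/-- a cell of status `s` tolerates a right neighbour of value `c` -/
def okk (s c : ℕ) : Bool := s != 0 || c == 2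

/-- the inequality for one transition -/
def good (s0 s1 s2 s3 c0 c1 c2 c3 : ℕ) : Bool :=
  Nat.ble (pot s0 s1 s2 s3 + 1)
    (pot (nx (th s0 + tw 0 + tw c0 + tw c1) c0) (nx (th s1 + tw c0 + tw c1 + tw c2) c1)
        (nx (th s2 + tw c1 + tw c2 + tw c3) c2) (nx (th s3 + tw c2 + tw c3 + tw 0) c3)
      + (exB s0 c0 + exB s1 c1 + exB s2 c2 + exB s3 c3)
      + (exA (th s0 + tw 0 + tw c0 + tw c1) c0 + exA (th s1 + tw c0 + tw c1 + tw c2) c1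
        + exA (th s2 + tw c1 + tw c2 + tw c3) c2 + exA (th s3 + tw c2 + tw c3 + tw 0) c3)
      + 2 * tw c0)

/-- the complete check of all transitions -/
def chk : Bool :=
  (List.range 4).all fun s0 => (List.range 3).all fun c0 => !okk s0 c0 ||
  (List.range 4).all fun s1 => (List.range 3).all fun c1 => !okk s1 c1 ||
  (List.range 4).all fun s2 => (List.range 3).all fun c2 => !okk s2 c2 ||
  (List.range 4).all fun s3 => (List.range 3).all fun c3 => good s0 s1 s2 s3 c0 c1 c2 c3

theorem chk_true : chk = true := by decide +kernel

theorem good_of {s0 s1 s2 s3 c0 c1 c2 c3 : ℕ} (h0 : s0 < 4) (h1 : s1 < 4) (h2 : s2 < 4)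
    (h3 : s3 < 4) (g0 : c0 < 3) (g1 : c1 < 3) (g2 : c2 < 3) (g3 : c3 < 3)
    (k0 : okk s0 c0 = true) (k1 : okk s1 c1 = true) (k2 : okk s2 c2 = true) :
    good s0 s1 s2 s3 c0 c1 c2 c3 = true := by
  have h := chk_true
  unfold chk at h
  have a0 := List.all_eq_true.1 (List.all_eq_true.1 h s0 (List.mem_range.2 h0)) c0
    (List.mem_range.2 g0)
  rw [k0, Bool.not_true, Bool.false_or] at a0
  have a1 := List.all_eq_true.1 (List.all_eq_true.1 a0 s1 (List.mem_range.2 h1)) c1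
    (List.mem_range.2 g1)
  rw [k1, Bool.not_true, Bool.false_or] at a1
  have a2 := List.all_eq_true.1 (List.all_eq_true.1 a1 s2 (List.mem_range.2 h2)) c2
    (List.mem_range.2 g2)
  rw [k2, Bool.not_true, Bool.false_or] at a2
  exact List.all_eq_true.1 (List.all_eq_true.1 a2 s3 (List.mem_range.2 h3)) c3
    (List.mem_range.2 g3)

theorem th_nx (k c : ℕ) : th (nx k c) = tw c := by
  unfold th nx tw; split_ifs <;> simp_all

theorem nx_lt (k c : ℕ) : nx k c < 4 := by
  unfold nx; split_ifs <;> omega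

/-- number of twos in the closed neighbourhood of row `i+1`, column `j` -/
def cnt {n : ℕ} [NeZero n] (x : ℕ → Fin n → ℕ) (i : ℕ) (j : Fin n) : ℕ :=
  tw (x (i+1) (j-1)) + tw (x i j) + tw (x (i+1) j) + tw (x (i+2) j) + tw (x (i+1) (j+1))

theorem cell (k l t c d : ℕ) (hc : c < 3) (h : c = 0 → k + t + l ≠ 0) (ht : t = tw d) :
    ((exA k c + exB (nx k c) d : ℕ) : ℤ) ≤ 2 * ((k + t + l : ℕ) : ℤ) + 5 * (on c : ℤ) - 2
      ∨ (c = 2 ∧ k = 0) := by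
  subst ht
  unfold exA exB nx on tw at *
  interval_cases c <;> by_cases hd : d = 2 <;> by_cases hk : k = 0 <;> simp_all <;> omega

theorem band {n : ℕ} [NeZero n] (x : ℕ → Fin n → ℕ) (hx : ∀ i j, x i j < 3)
    (hz : ∀ j, x 0 j = 0) (hdom : ∀ i < 4, ∀ j, x (i+1) j = 0 → cnt x i j ≠ 0) :
    (n : ℤ) ≤ ∑ i ∈ Finset.range 4, ∑ j, (2 * (cnt x i j : ℤ) + 5 * (on (x (i+1) j) : ℤ) - 2)
      + 2 * ∑ j, (tw (x 1 j) : ℤ) := by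
  classical
  -- count of twos without the right neighbour, and for the last row without the row below
  let k : ℕ → Fin n → ℕ := fun i j =>
    tw (x (i+1) (j-1)) + tw (x i j) + tw (x (i+1) j) + (if i = 3 then 0 else tw (x (i+2) j))
  let s : ℕ → Fin n → ℕ := fun i j => nx (k i j) (x (i+1) j)
  let P : Fin n → ℕ := fun j => pot (s 0 j) (s 1 j) (s 2 j) (s 3 j)
  let B : Fin n → ℕ := fun j => exB (s 0 j) (x 1 (j+1)) + exB (s 1 j) (x 2 (j+1))
    + exB (s 2 j) (x 3 (j+1)) + exB (s 3 j) (x 4 (j+1))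
  let A : Fin n → ℕ := fun j => exA (k 0 j) (x 1 j) + exA (k 1 j) (x 2 j)
    + exA (k 2 j) (x 3 j) + exA (k 3 j) (x 4 j)
  have hok : ∀ i < 3, ∀ j, okk (s i j) (x (i+1) (j+1)) = true := by
    intro i hi j
    have h := hdom i (by omega) j
    have h3 : i ≠ 3 := by omega
    simp only [okk, s, k, nx, cnt, tw, if_neg h3] at h ⊢
    have := hx (i+1) j
    by_cases e2 : x (i+1) j = 2
    · simp [e2]
    by_cases e1 : x (i+1) j = 1
    · simp [e1]
    have e0 : x (i+1) j = 0 := by omega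
    by_cases e : x (i+1) (j+1) = 2
    · simp [e]
    have := h e0
    simp only [e, if_false, add_zero] at this
    simp [e0] at this ⊢
    tauto
  have key : ∀ j, P j + 1 ≤ P (j+1) + B j + A (j+1) + 2 * tw (x 1 (j+1)) := by
    intro j
    have h := good_of (nx_lt (k 0 j) (x 1 j)) (nx_lt (k 1 j) (x 2 j)) (nx_lt (k 2 j) (x 3 j))
      (nx_lt (k 3 j) (x 4 j)) (hx 1 (j+1)) (hx 2 (j+1)) (hx 3 (j+1)) (hx 4 (j+1))
      (hok 0 (by norm_num) j) (hok 1 (by norm_num) j) (hok 2 (by norm_num) j)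
    unfold good at h
    simp only [th_nx] at h
    have h' := Nat.le_of_ble_eq_true h
    have r0 : k 0 (j+1) = tw (x 1 j) + tw 0 + tw (x 1 (j+1)) + tw (x 2 (j+1)) := by
      simp [k, hz]
    have r1 : k 1 (j+1) = tw (x 2 j) + tw (x 1 (j+1)) + tw (x 2 (j+1)) + tw (x 3 (j+1)) := by
      simp [k]
    have r2 : k 2 (j+1) = tw (x 3 j) + tw (x 2 (j+1)) + tw (x 3 (j+1)) + tw (x 4 (j+1)) := by
      simp [k]
    have r3 : k 3 (j+1) = tw (x 4 j) + tw (x 3 (j+1)) + tw (x 4 (j+1)) + tw 0 := by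
      simp [k, tw]
    rw [← r0, ← r1, ← r2, ← r3] at h'
    exact h'
  have hcell : ∀ i < 4, ∀ j, ((exA (k i j) (x (i+1) j) + exB (s i j) (x (i+1) (j+1)) : ℕ) : ℤ)
      ≤ 2 * (cnt x i j : ℤ) + 5 * (on (x (i+1) j) : ℤ) - 2 := by
    intro i hi j
    have hc : cnt x i j = k i j + tw (x (i+1) (j+1)) + (if i = 3 then tw (x (i+2) j) else 0) := by
      simp only [cnt, k]; split_ifs <;> ring
    rw [hc]
    rcases cell (k i j) (if i = 3 then tw (x (i+2) j) else 0) _ (x (i+1) j) (x (i+1) (j+1))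
      (hx _ _) (fun h => by rw [← hc]; exact hdom i hi j h) rfl with h | ⟨h1, h2⟩
    · exact h
    · simp only [k, h1, tw] at h2
      simp at h2
  have hsum := Finset.sum_le_sum (fun j (_ : j ∈ (Finset.univ : Finset (Fin n))) => key j)
  simp only [Finset.sum_add_distrib, ← Finset.mul_sum] at hsum
  have sh : ∀ g : Fin n → ℕ, ∑ j, g (j+1) = ∑ j, g j := fun g =>
    Equiv.sum_comp (Equiv.addRight (1 : Fin n)) g
  rw [sh P, sh A, sh (fun j => tw (x 1 j))] at hsum
  simp at hsum
  have h2 : ∑ j, ((A j : ℤ) + (B j : ℤ)) ≤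
      ∑ i ∈ Finset.range 4, ∑ j, (2 * (cnt x i j : ℤ) + 5 * (on (x (i+1) j) : ℤ) - 2) := by
    rw [Finset.sum_comm]
    refine Finset.sum_le_sum fun j _ => ?_
    have a0 := hcell 0 (by norm_num) j
    have a1 := hcell 1 (by norm_num) j
    have a2 := hcell 2 (by norm_num) j
    have a3 := hcell 3 (by norm_num) j
    simp only [Finset.sum_range_succ, Finset.sum_range_zero]
    simp only [A, B]
    push_cast at a0 a1 a2 a3 ⊢
    linarith
  rw [Finset.sum_add_distrib] at h2
  zify at hsum
  linarith

theorem tw_on (a : ℕ) (h : a < 3) : (a : ℤ) = 2 * (tw a : ℤ) + (on a : ℤ) := by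
  unfold tw on; interval_cases a <;> simp

theorem tele (T : ℕ → ℤ) (m : ℕ) :
    ∑ i ∈ Finset.range m, (3 * T (i+1) + T i + T (i+2))
      = 5 * ∑ i ∈ Finset.range m, T (i+1) + T 0 - T m + T (m+1) - T 1 := by
  induction m with
  | zero => simp
  | succ m ih => rw [Finset.sum_range_succ, ih, Finset.sum_range_succ]; ring

theorem lower {m n : ℕ} [NeZero n] (hm : 8 ≤ m) (x : ℕ → Fin n → ℕ) (hx : ∀ i j, x i j < 3)
    (hz : ∀ j, x 0 j = 0) (hz' : ∀ j, x (m+1) j = 0)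
    (hdom : ∀ i < m, ∀ j, x (i+1) j = 0 → cnt x i j ≠ 0) :
    2 * ((m : ℤ) + 1) * n ≤ 5 * ∑ i ∈ Finset.range m, ∑ j, (x (i+1) j : ℤ) := by
  classical
  let y : ℕ → Fin n → ℕ := fun i => x (m+1-i)
  let E : ℕ → ℤ := fun i => ∑ j, (2 * (cnt x i j : ℤ) + 5 * (on (x (i+1) j) : ℤ) - 2)
  let T : ℕ → ℤ := fun i => ∑ j, (tw (x i j) : ℤ)
  have hrefl : ∀ i < m, ∀ j, cnt y i j = cnt x (m-1-i) j := by
    intro i hi j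
    simp only [cnt, y]
    rw [show m + 1 - (i+1) = m-1-i+1 by omega, show m+1-i = m-1-i+2 by omega,
      show m+1-(i+2) = m-1-i by omega]
    ring
  have b1 := band x hx hz (fun i hi j h => hdom i (by omega) j h)
  have b2 := band y (fun i j => hx _ _) (fun j => hz' j) (fun i hi j h => by
    rw [hrefl i (by omega)]
    apply hdom _ (by omega)
    rw [show m-1-i+1 = m+1-(i+1) by omega]; exact h)
  have e2 : ∑ i ∈ Finset.range 4, ∑ j, (2 * (cnt y i j : ℤ) + 5 * (on (y (i+1) j) : ℤ) - 2)
      = ∑ i ∈ Finset.range 4, E (m-1-i) := by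
    refine Finset.sum_congr rfl fun i hi => Finset.sum_congr rfl fun j _ => ?_
    have hi := Finset.mem_range.1 hi
    rw [hrefl i (by omega)]
    simp only [y]
    rw [show m-1-i+1 = m+1-(i+1) by omega]
  rw [e2] at b2
  have b1' : (n : ℤ) ≤ ∑ i ∈ Finset.range 4, E i + 2 * T 1 := b1
  have b2' : (n : ℤ) ≤ ∑ i ∈ Finset.range 4, E (m-1-i) + 2 * T m := b2
  have hE : ∀ i < m, 0 ≤ E i := by
    intro i hi
    refine Finset.sum_nonneg fun j _ => ?_
    have h1 := hdom i hi j
    have h2 := hx (i+1) j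
    have h3 : x (i+1) j = 0 ∨ x (i+1) j = 1 ∨ x (i+1) j = 2 := by omega
    rcases h3 with h | h | h
    · have := h1 h
      have : 1 ≤ cnt x i j := by omega
      zify at this
      have : (0:ℤ) ≤ on (x (i+1) j) := by positivity
      linarith
    · have : on (x (i+1) j) = 1 := by simp [on, h]
      rw [this]; push_cast
      have : (0:ℤ) ≤ cnt x i j := by positivity
      linarith
    · have : 1 ≤ cnt x i j := by simp only [cnt, h, tw]; simp; omega
      zify at this
      have : (0:ℤ) ≤ on (x (i+1) j) := by positivity
      linarith
  have hsplit : ∑ i ∈ Finset.range 4, E i + ∑ i ∈ Finset.range 4, E (m-1-i)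
      ≤ ∑ i ∈ Finset.range m, E i := by
    obtain ⟨k, rfl⟩ : ∃ k, m = k + 4 + 4 := ⟨m - 8, by omega⟩
    have h := Finset.sum_le_sum_of_subset_of_nonneg (f := E)
      (Finset.range_mono (show 4 ≤ k + 4 by omega))
      (fun i hi _ => hE i (by have := Finset.mem_range.1 hi; omega))
    have h' : ∑ i ∈ Finset.range 4, E (k+4+4-1-i) = E (k+4) + E (k+4+1) + E (k+4+2) + E (k+4+3) := by
      rw [← Finset.sum_range_reflect]
      simp only [Finset.sum_range_succ, Finset.sum_range_zero]
      simp
    rw [h']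
    rw [Finset.sum_range_succ _ (k+4+3), Finset.sum_range_succ _ (k+4+2),
      Finset.sum_range_succ _ (k+4+1), Finset.sum_range_succ _ (k+4)]
    linarith
  have sh : ∀ g : Fin n → ℤ, ∑ j, g (j+1) = ∑ j, g j := fun g =>
    Equiv.sum_comp (Equiv.addRight (1 : Fin n)) g
  have sh' : ∀ g : Fin n → ℤ, ∑ j, g (j-1) = ∑ j, g j := fun g =>
    Equiv.sum_comp (Equiv.subRight (1 : Fin n)) g
  have hrow : ∀ i, E i = 2 * (3 * T (i+1) + T i + T (i+2)) + 5 * ∑ j, (on (x (i+1) j) : ℤ)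
      - 2 * n := by
    intro i
    simp only [E, T, cnt]
    push_cast
    simp only [Finset.sum_sub_distrib, Finset.sum_add_distrib, ← Finset.mul_sum]
    rw [sh (fun j => (tw (x (i+1) j) : ℤ)), sh' (fun j => (tw (x (i+1) j) : ℤ))]
    simp
    ring
  have hw : ∀ i, ∑ j, (x (i+1) j : ℤ) = 2 * T (i+1) + ∑ j, (on (x (i+1) j) : ℤ) := by
    intro i
    simp only [T]
    rw [Finset.mul_sum, ← Finset.sum_add_distrib]
    exact Finset.sum_congr rfl fun j _ => tw_on _ (hx _ _)
  have t0 : T 0 = 0 := by simp [T, hz, tw]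
  have t1 : T (m+1) = 0 := by simp [T, hz', tw]
  have htot : ∑ i ∈ Finset.range m, E i
      = 5 * ∑ i ∈ Finset.range m, ∑ j, (x (i+1) j : ℤ) - 2 * T 1 - 2 * T m - 2 * m * n := by
    simp only [hrow, hw]
    rw [Finset.sum_sub_distrib, Finset.sum_add_distrib, ← Finset.mul_sum, tele, ← Finset.mul_sum,
      Finset.sum_add_distrib, t0, t1]
    have h2 : ∑ i ∈ Finset.range m, 2 * T (i+1) = 2 * ∑ i ∈ Finset.range m, T (i+1) :=
      (Finset.mul_sum _ _ _).symm
    rw [h2]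
    simp
    ring
  linarith

theorem lower_graph {m n : ℕ} (hm : 10 ≤ m) (hn : 10 ≤ n) (f : Fin m × Fin n → Fin 3)
    (hf : IsRomanDominating ((pathGraph m).boxProd (cycleGraph n)) f) :
    2 * (m + 1) * n ≤ 5 * ∑ v, (f v : ℕ) := by
  have : NeZero n := ⟨by omega⟩
  let x : ℕ → Fin n → ℕ := fun i j =>
    if h : 1 ≤ i ∧ i ≤ m then (f (⟨i - 1, by omega⟩, j) : ℕ) else 0
  have hxv : ∀ (i : Fin m) j, x (i+1) j = f (i, j) := by
    intro i j
    have : 1 ≤ (i:ℕ) + 1 ∧ (i:ℕ) + 1 ≤ m := by omega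
    simp only [x, dif_pos this]; simp
  have h := lower (m := m) (by omega) x (fun i j => by
      simp only [x]; split_ifs
      · exact Fin.isLt _
      · norm_num) (fun j => by simp [x]) (fun j => by simp [x]) (by
    intro i hi j h0
    have e := hxv ⟨i, hi⟩ j
    simp only at e
    rw [h0] at e
    obtain ⟨⟨a, b⟩, hadj, h2⟩ := hf (⟨i, hi⟩, j) (Fin.ext (by simpa using e.symm))
    have ha := hxv a b
    rw [h2] at ha
    have ha : x (a+1) b = 2 := by rw [ha]; rfl
    rw [boxProd_adj] at hadj
    simp only at hadj
    have fin : ∀ {a' b'}, x a' b' = 2 → tw (x a' b') = 1 := fun h => by simp [tw, h]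
    have ha := fin ha
    unfold cnt
    rcases hadj with ⟨h1, rfl⟩ | ⟨h1, h3⟩
    · rw [pathGraph_adj] at h1
      simp only at h1
      rcases h1 with h1 | h1
      · rw [← h1] at ha
        have : tw (x (i+2) j) = 1 := ha
        omega
      · rw [h1] at ha; omega
    · subst h3
      simp only at ha
      rw [cycleGraph_adj'] at h1
      have one : ((1 : Fin n) : ℕ) = 1 := by
        rw [Fin.val_one']; exact Nat.mod_eq_of_lt (by omega)
      rcases h1 with h1 | h1
      · have : j - b = 1 := Fin.ext (by rw [h1, one])
        have : b = j - 1 := by rw [← this]; abel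
        rw [this] at ha; omega
      · have : b - j = 1 := Fin.ext (by rw [h1, one])
        have : b = j + 1 := by rw [← this]; abel
        rw [this] at ha; omega)
  rw [Fintype.sum_prod_type]
  have e : ∑ i ∈ Finset.range m, ∑ j, x (i+1) j = ∑ i : Fin m, ∑ j, (f (i, j) : ℕ) := by
    rw [Finset.sum_range]
    exact Finset.sum_congr rfl fun i _ => Finset.sum_congr rfl fun j _ => hxv i j
  rw [← e]
  exact_mod_cast h

theorem count5 (q c : ℕ) :
    ∑ j : Fin (5 * q), (if ((j : ℕ) + c) % 5 = 0 then 1 else 0) = q := by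
  rw [Fin.sum_univ_eq_sum_range (fun j => if (j + c) % 5 = 0 then 1 else 0)]
  induction q with
  | zero => simp
  | succ q ih =>
    rw [show 5 * (q+1) = 5 * q + 1 + 1 + 1 + 1 + 1 by ring]
    simp only [Finset.sum_range_succ, ih]
    have : c % 5 < 5 := Nat.mod_lt _ (by norm_num)
    split_ifs <;> omega

/-- the optimal function -/
def opt (m n : ℕ) (v : Fin m × Fin n) : Fin 3 :=
  if ((v.2 : ℕ) + 2 * v.1) % 5 = 0 then 2
  else if (v.1 : ℕ) = 0 ∧ ((v.2 : ℕ) + 3) % 5 = 0 then 1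
  else if (v.1 : ℕ) + 1 = m ∧ ((v.2 : ℕ) + 2 * m) % 5 = 0 then 1
  else 0

theorem opt_dom {m n : ℕ} (hm : 10 ≤ m) (hn : 10 ≤ n) (h5 : n % 5 = 0) :
    IsRomanDominating ((pathGraph m).boxProd (cycleGraph n)) (opt m n) := by
  rintro ⟨i, j⟩ h
  have hi := i.isLt
  have hj := j.isLt
  by_cases r0 : ((j : ℕ) + 2 * i) % 5 = 0
  · simp [opt, r0] at h
  by_cases p1 : (i : ℕ) = 0 ∧ ((j : ℕ) + 3) % 5 = 0
  · simp only [opt, if_neg r0, if_pos p1] at h; simp at h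
  by_cases p2 : (i : ℕ) + 1 = m ∧ ((j : ℕ) + 2 * m) % 5 = 0
  · simp only [opt, if_neg r0, if_neg p1, if_pos p2] at h; simp at h
  have two : ∀ (a : Fin m) (b : Fin n), ((b : ℕ) + 2 * a) % 5 = 0 → opt m n (a, b) = 2 := by
    intro a b hab
    simp only [opt, if_pos hab]
  have r : ((j : ℕ) + 2 * i) % 5 = 1 ∨ ((j : ℕ) + 2 * i) % 5 = 2 ∨ ((j : ℕ) + 2 * i) % 5 = 3
    ∨ ((j : ℕ) + 2 * i) % 5 = 4 := by omega
  simp only [boxProd_adj, pathGraph_adj, cycleGraph_adj', Fin.val_sub]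
  rcases r with r | r | r | r
  · by_cases hj0 : (j : ℕ) = 0
    · refine ⟨(i, ⟨n-1, by omega⟩), Or.inr ⟨Or.inl ?_, rfl⟩, two _ _ (by simp only; omega)⟩
      simp only
      rw [hj0, show n - (n-1) + 0 = 1 by omega]
      exact Nat.mod_eq_of_lt (by omega)
    · refine ⟨(i, ⟨j-1, by omega⟩), Or.inr ⟨Or.inl ?_, rfl⟩, two _ _ (by simp only; omega)⟩
      simp only
      rw [show n - ((j:ℕ)-1) + j = 1 + n by omega, Nat.add_mod_right]
      exact Nat.mod_eq_of_lt (by omega)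
  · have : (i : ℕ) ≠ 0 := by omega
    exact ⟨(⟨i-1, by omega⟩, j), Or.inl ⟨Or.inr (by simp only; omega), rfl⟩,
      two _ _ (by simp only; omega)⟩
  · have : (i : ℕ) + 1 ≠ m := by omega
    exact ⟨(⟨i+1, by omega⟩, j), Or.inl ⟨Or.inl (by simp only), rfl⟩,
      two _ _ (by simp only; omega)⟩
  · by_cases hj0 : (j : ℕ) + 1 = n
    · refine ⟨(i, ⟨0, by omega⟩), Or.inr ⟨Or.inr ?_, rfl⟩, two _ _ (by simp only; omega)⟩
      simp only
      rw [show n - (j:ℕ) + 0 = 1 by omega]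
      exact Nat.mod_eq_of_lt (by omega)
    · refine ⟨(i, ⟨j+1, by omega⟩), Or.inr ⟨Or.inr ?_, rfl⟩, two _ _ (by simp only; omega)⟩
      simp only
      rw [show n - (j:ℕ) + (j+1) = 1 + n by omega, Nat.add_mod_right]
      exact Nat.mod_eq_of_lt (by omega)

theorem opt_weight {m q : ℕ} (hm : 10 ≤ m) :
    ∑ v, (opt m (5 * q) v : ℕ) = 2 * (m + 1) * q := by
  have hv : ∀ (i : Fin m) (j : Fin (5*q)), (opt m (5*q) (i, j) : ℕ) =
      2 * (if ((j : ℕ) + 2 * i) % 5 = 0 then 1 else 0)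
      + (if i = ⟨0, by omega⟩ then 1 else 0) * (if ((j : ℕ) + 3) % 5 = 0 then 1 else 0)
      + (if i = ⟨m-1, by omega⟩ then 1 else 0) * (if ((j : ℕ) + 2 * m) % 5 = 0 then 1 else 0) := by
    intro i j
    have a1 : i = ⟨0, by omega⟩ ↔ (i : ℕ) = 0 := by rw [Fin.ext_iff]
    have a2 : i = ⟨m-1, by omega⟩ ↔ (i : ℕ) + 1 = m := by rw [Fin.ext_iff]; simp only; omega
    simp only [opt, a1, a2]
    split_ifs <;> first | rfl | omega
  rw [Fintype.sum_prod_type]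
  simp only [hv, Finset.sum_add_distrib, ← Finset.mul_sum, count5, ← Finset.sum_mul,
    Finset.sum_const, Finset.card_univ, Fintype.card_fin, Finset.sum_ite_eq', Finset.mem_univ,
    if_true, smul_eq_mul]
  ring

end RomanCyl

/-- for `m, n ≥ 10` with `n ≡ 0 (mod 5)`,
`γ_R(P_m □ C_n) = 2(m+1)n/5` (the division is exact since `5 ∣ n`). -/
theorem romanDominationNumber_cylinder_of_mod_five_eq_zero (m n : ℕ)
    (hm : 10 ≤ m) (hn : 10 ≤ n) (h5 : n % 5 = 0) :
    romanDominationNumber ((pathGraph m).boxProd (cycleGraph n)) = 2 * (m + 1) * n / 5 := by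
  obtain ⟨q, rfl⟩ : ∃ q, n = 5 * q := ⟨n / 5, by omega⟩
  have e : 2 * (m + 1) * (5 * q) / 5 = 2 * (m + 1) * q := by
    rw [show 2 * (m + 1) * (5 * q) = 2 * (m + 1) * q * 5 by ring]
    exact Nat.mul_div_cancel _ (by norm_num)
  rw [e]
  unfold romanDominationNumber
  have hmem : 2 * (m + 1) * q ∈ {k | ∃ f : Fin m × Fin (5 * q) → Fin 3,
      IsRomanDominating ((pathGraph m).boxProd (cycleGraph (5 * q))) f ∧
      ∑ v, (f v : ℕ) = k} :=
    ⟨_, RomanCyl.opt_dom hm hn h5, RomanCyl.opt_weight hm⟩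
  refine le_antisymm (Nat.sInf_le hmem) (le_csInf ⟨_, hmem⟩ ?_)
  rintro k ⟨f, hf, rfl⟩
  have h := RomanCyl.lower_graph hm hn f hf
  have h2 : 2 * (m + 1) * (5 * q) = 5 * (2 * (m + 1) * q) := by ring
  rw [h2] at h
  exact Nat.le_of_mul_le_mul_left h (by norm_num)
end
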